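/- arXiv:1604.02605 — 4 statements merged into one kernel-verified Lean document; each statement's English description precedes it below -/
import Mathlib

section
/- An n,k-complete perfect phylogeny tree T generates a frequency tensor F if and only if f⁺_p(D_{(c,i)}) − Σ_{(d,j)∈δ(c,i)} f⁺_p(D_{(d,j)}) ≥ 0 for all character-state pairs (c,i) (including the root (*,0)) and all samples p (the multi-state sum condition, MSSC). -/
open Finset
open scoped Classical

/-- Vertices of an `n,k`-complete perfect phylogeny tree: `none` is the root
`v_{(*,0)}`, and `some (c, i)` with `i ≠ 0` is the vertex `v_{(c,i)}`. -/
abbrev PPVert (n k : ℕ) [NeZero k] : Type :=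
  Option (Fin n × {i : Fin k // i ≠ 0})

/-- An `n,k`-complete perfect phylogeny tree: each of the `n(k-1)` non-root
vertices `v_{(c,i)}` is the head of the unique edge labeled `(c,i)` and has a
parent vertex; a depth function witnesses acyclicity (so the parent map
generates a tree rooted at the root `none`). -/
structure CPPTree (n k : ℕ) [NeZero k] where
  parent : Fin n → {i : Fin k // i ≠ 0} → PPVert n k
  depth : PPVert n k → ℕ
  depth_lt : ∀ c i, depth (parent c i) < depth (some (c, i))

variable {m n k : ℕ} [NeZero k]

/-- The vertex `v_{(c,i)}`; for `i = 0` this is the root `v_{(*,0)}`. -/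
def vtx (c : Fin n) (i : Fin k) : PPVert n k :=
  if h : i = 0 then none else some (c, ⟨i, h⟩)

namespace CPPTree

/-- `childRel T u v` holds when `u` is the parent of `v` in `T`. -/
def childRel (T : CPPTree n k) (u v : PPVert n k) : Prop :=
  ∃ c i, v = some (c, i) ∧ T.parent c i = u

/-- The (reflexive) ancestor relation `≺_T` on the vertices of `T`. -/
def anc (T : CPPTree n k) : PPVert n k → PPVert n k → Prop :=
  Relation.ReflTransGen T.childRel

/-- The descendant set `D_{(c,i)} = { j | (c,i) ≺_T (c,j) }`. -/
noncomputable def D (T : CPPTree n k) (c : Fin n) (i : Fin k) : Finset (Fin k) :=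
  Finset.univ.filter fun j => T.anc (vtx c i) (vtx c j)

/-- The labels of the children of a vertex `v` of `T`. -/
noncomputable def childrenOf (T : CPPTree n k) (v : PPVert n k) :
    Finset (Fin n × {i : Fin k // i ≠ 0}) :=
  Finset.univ.filter fun dj => T.parent dj.1 dj.2 = v

/-- `δ(c,i)`: the labels of the children of the vertex `v_{(c,i)}`. -/
noncomputable def children (T : CPPTree n k) (c : Fin n) (i : Fin k) :
    Finset (Fin n × {i : Fin k // i ≠ 0}) :=
  T.childrenOf (vtx c i)

end CPPTree

/-- `f` is a `k × m × n` frequency tensor. -/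
def IsFreqTensor (f : Fin m → Fin n → Fin k → ℝ) : Prop :=
  (∀ p c i, 0 ≤ f p c i) ∧ ∀ p c, ∑ i, f p c i = 1

/-- The cumulative frequency `f⁺_p(D)` of `D` for character `c` in sample `p`. -/
noncomputable def fplus (f : Fin m → Fin n → Fin k → ℝ) (p : Fin m) (c : Fin n)
    (D : Finset (Fin k)) : ℝ :=
  ∑ l ∈ D, f p c l

/-- The usage `u_{p,(c,i)} = f⁺_p(D_{(c,i)}) − Σ_{(d,j)∈δ(c,i)} f⁺_p(D_{(d,j)})`
of a vertex in sample `p`; for the root, `f⁺_p(D_{(*,0)}) = 1`. -/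
noncomputable def usage (T : CPPTree n k) (f : Fin m → Fin n → Fin k → ℝ)
    (p : Fin m) : PPVert n k → ℝ
  | none => 1 - ∑ dj ∈ T.childrenOf none, fplus f p dj.1 (T.D dj.1 dj.2.1)
  | some (c, i) =>
      fplus f p c (T.D c i.1) - ∑ dj ∈ T.children c i.1, fplus f p dj.1 (T.D dj.1 dj.2.1)

/-- `v ∈ T_{(c,i)}`: the state vector of `v` has state `i` for character `c`,
i.e. `v_{(c,i)}` is the lowest ancestor of `v` among the vertices `v_{(c,j)}`. -/
def CPPTree.hasState (T : CPPTree n k) (v : PPVert n k) (c : Fin n) (i : Fin k) : Prop :=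
  T.anc (vtx c i) v ∧ ∀ j : Fin k, T.anc (vtx c j) v → T.anc (vtx c j) (vtx c i)

/-- `T_{(c,i)}`: the set of vertices whose state vector has state `i` at `c`. -/
noncomputable def CPPTree.stateSet (T : CPPTree n k) (c : Fin n) (i : Fin k) :
    Finset (PPVert n k) :=
  Finset.univ.filter fun v => T.hasState v c i


/-- `T` generates `F`: the matrix `U` defined by
`u_{p,(c,i)} = f⁺_p(D_{(c,i)}) − Σ_{(d,j)∈δ(c,i)} f⁺_p(D_{(d,j)})` is an
`m,n,k`-usage matrix, i.e. has nonnegative entries and rows summing to 1. -/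
def Generates (T : CPPTree n k) (f : Fin m → Fin n → Fin k → ℝ) : Prop :=
  (∀ (p : Fin m) (v : PPVert n k), 0 ≤ usage T f p v) ∧
    ∀ p : Fin m, ∑ v : PPVert n k, usage T f p v = 1

/-- The multi-state sum condition (MSSC):
`f⁺_p(D_{(c,i)}) − Σ_{(d,j)∈δ(c,i)} f⁺_p(D_{(d,j)}) ≥ 0` for all
character-state pairs `(c,i)` (including the root, via `i = 0`) and all
samples `p`. -/
def MSSC (T : CPPTree n k) (f : Fin m → Fin n → Fin k → ℝ) : Prop :=
  ∀ (p : Fin m) (c : Fin n) (i : Fin k),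
    0 ≤ fplus f p c (T.D c i) - ∑ dj ∈ T.children c i, fplus f p dj.1 (T.D dj.1 dj.2.1)

theorem CPPTree.anc_root (T : CPPTree n k) (v : PPVert n k) : T.anc none v := by
  induction hd : T.depth v using Nat.strong_induction_on generalizing v with
  | _ d ih =>
    rcases v with _ | ⟨c, i⟩
    · exact Relation.ReflTransGen.refl
    · exact Relation.ReflTransGen.tail (ih _ (hd ▸ T.depth_lt c i) _ rfl) ⟨c, i, rfl, rfl⟩

theorem CPPTree.D_zero (T : CPPTree n k) (c : Fin n) : T.D c 0 = Finset.univ := by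
  ext j
  simp [CPPTree.D, vtx, T.anc_root]

theorem sum_usage (T : CPPTree n k) (f : Fin m → Fin n → Fin k → ℝ) (p : Fin m) :
    ∑ v : PPVert n k, usage T f p v = 1 := by
  have h : ∑ v : PPVert n k, ∑ dj ∈ T.childrenOf v, fplus f p dj.1 (T.D dj.1 dj.2.1)
      = ∑ dj : Fin n × {i : Fin k // i ≠ 0}, fplus f p dj.1 (T.D dj.1 dj.2.1) := by
    exact Finset.sum_fiberwise _ _ _
  rw [Fintype.sum_option] at h ⊢
  have e : ∀ x : Fin n × {i : Fin k // i ≠ 0}, usage T f p (some x) =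
      fplus f p x.1 (T.D x.1 x.2.1) -
        ∑ dj ∈ T.childrenOf (some x), fplus f p dj.1 (T.D dj.1 dj.2.1) := by
    rintro ⟨c, i, hi⟩
    simp [usage, CPPTree.children, vtx, hi]
  simp only [e, Finset.sum_sub_distrib]
  simp only [usage]
  linarith

theorem usage_vtx (T : CPPTree n k) (f : Fin m → Fin n → Fin k → ℝ)
    (hf : IsFreqTensor f) (p : Fin m) (c : Fin n) (i : Fin k) :
    usage T f p (vtx c i) = fplus f p c (T.D c i) -
      ∑ dj ∈ T.children c i, fplus f p dj.1 (T.D dj.1 dj.2.1) := by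
  by_cases hi : i = 0
  · subst hi
    rw [T.D_zero]
    simp [usage, CPPTree.children, vtx, fplus, hf.2 p c]
  · simp [usage, vtx, hi]

/-- **Theorem 1.** An `n,k`-complete perfect phylogeny tree `T`
generates a frequency tensor `F` if and only if the multi-state sum condition
holds for all character-state pairs and all samples. -/
theorem generates_iff_MSSC (T : CPPTree n k) (f : Fin m → Fin n → Fin k → ℝ)
    (hf : IsFreqTensor f) :
    Generates T f ↔ MSSC T f := by
  constructor
  · intro h p c i
    rw [← usage_vtx T f hf]
    exact h.1 p _
  · intro h
    refine ⟨fun p v => ?_, sum_usage T f⟩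
    rcases v with _ | ⟨c, i⟩
    · rcases Nat.eq_zero_or_pos n with hn | hn
      · subst hn
        have he : T.childrenOf none = ∅ :=
          Finset.eq_empty_of_forall_notMem fun x => x.1.elim0
        simp [usage, he]
      · have := h p ⟨0, hn⟩ 0
        rw [← usage_vtx T f hf] at this
        simpa [vtx] using this
    · exact h p c i.1
end

section
/- Let T be an n,k-complete perfect phylogeny tree that generates a frequency tensor F. If (c,i) ≺_T (d,j) with (c,i) ≠ (d,j) and v_{(c,i)} is not the root, then the sets D_{(c,i)} = {1,…,k−1} and D_{(d,j)} = {j} form a valid descendant set pair (D_{(c,i)}, D_{(d,j)}). -/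
open Finset
open scoped Classical

variable {m n k : ℕ} [NeZero k]

/-- `(D_{(c,i)}, D_{(d,j)})` is a valid descendant set pair for the (distinct)
character-state pairs `(c,i)` and `(d,j)`:
`f⁺_p(D_{(c,i)}) − f⁺_p(D_{(d,j)}) ≥ 0` for all samples `p`, and when `c = d`
additionally `D_{(d,j)} ⊊ D_{(c,i)}`. -/
def ValidPair (f : Fin m → Fin n → Fin k → ℝ) (c : Fin n) (i : Fin k)
    (d : Fin n) (j : Fin k) (Dci Ddj : Finset (Fin k)) : Prop :=
  (∀ p : Fin m, 0 ≤ fplus f p c Dci - fplus f p d Ddj) ∧ (c = d → Ddj ⊂ Dci)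

theorem vtx_sub (c : Fin n) (i : {i : Fin k // i ≠ 0}) : vtx c i.1 = some (c, i) := by
  unfold vtx
  rw [dif_neg i.2]

theorem anc_mono (T : CPPTree n k) (f : Fin m → Fin n → Fin k → ℝ)
    (hf : IsFreqTensor f) (hgen : Generates T f) (a : Fin n × {i : Fin k // i ≠ 0})
    (w : PPVert n k) (h : T.anc (some a) w) :
    ∃ b : Fin n × {i : Fin k // i ≠ 0}, w = some b ∧
      ∀ p, fplus f p b.1 (T.D b.1 b.2.1) ≤ fplus f p a.1 (T.D a.1 a.2.1) := by
  induction h with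
  | refl => exact ⟨a, rfl, fun p => le_refl _⟩
  | tail _ hc ih =>
    obtain ⟨b, rfl, hb⟩ := ih
    obtain ⟨d, j, rfl, hp⟩ := hc
    refine ⟨(d, j), rfl, fun p => le_trans ?_ (hb p)⟩
    have hu := hgen.1 p (some (b.1, b.2))
    simp only [usage, CPPTree.children, vtx_sub] at hu
    have hmem : (d, j) ∈ T.childrenOf (some (b.1, b.2)) := by
      simp [CPPTree.childrenOf, hp]
    have hs := Finset.single_le_sum
      (f := fun dj : Fin n × {i : Fin k // i ≠ 0} => fplus f p dj.1 (T.D dj.1 dj.2.1))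
      (fun x _ => Finset.sum_nonneg fun l _ => hf.1 p x.1 l) hmem
    dsimp only at hs ⊢
    linarith

/-- **Corollary 1.** Let `T` be an `n,k`-complete perfect
phylogeny tree that generates the frequency tensor `F`.  If
`(c,i) ≺_T (d,j)`, `(c,i) ≠ (d,j)` and `v_{(c,i)}` is not the root (`i ≠ 0`),
then `D_{(c,i)} = {1,…,k−1}` and `D_{(d,j)} = {j}` form a valid descendant set
pair. -/
theorem extreme_validPair (T : CPPTree n k) (f : Fin m → Fin n → Fin k → ℝ)
    (hf : IsFreqTensor f) (hgen : Generates T f)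
    (c d : Fin n) (i j : Fin k)
    (hanc : T.anc (vtx c i) (vtx d j)) (hne : (c, i) ≠ (d, j)) (hi : i ≠ 0) :
    ValidPair f c i d j (Finset.univ.filter fun l : Fin k => l ≠ 0) {j} := by
  have hv : vtx c i = some (c, (⟨i, hi⟩ : {i : Fin k // i ≠ 0})) := vtx_sub c ⟨i, hi⟩
  rw [hv] at hanc
  obtain ⟨b, hb, hle⟩ := anc_mono T f hf hgen _ _ hanc
  have hj : j ≠ 0 := by
    rintro rfl
    simp [vtx] at hb
  have hb2 : b = (d, ⟨j, hj⟩) := by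
    have := vtx_sub d (⟨j, hj⟩ : {i : Fin k // i ≠ 0})
    exact Option.some_injective _ (hb.symm.trans this)
  subst hb2
  refine ⟨fun p => ?_, ?_⟩
  · have h1 : fplus f p d {j} ≤ fplus f p d (T.D d j) := by
      apply Finset.sum_le_sum_of_subset_of_nonneg
      · intro x hx
        rw [Finset.mem_singleton] at hx
        subst hx
        simp only [CPPTree.D, Finset.mem_filter, Finset.mem_univ, true_and]
        exact Relation.ReflTransGen.refl
      · intro x _ _
        exact hf.1 p d x
    have h2 : fplus f p c (T.D c i) ≤ fplus f p c (Finset.univ.filter fun l : Fin k => l ≠ 0) := by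
      apply Finset.sum_le_sum_of_subset_of_nonneg
      · intro x hx
        simp only [CPPTree.D, Finset.mem_filter, Finset.mem_univ, true_and] at hx ⊢
        rintro rfl
        rw [hv] at hx
        obtain ⟨b, hb, -⟩ := anc_mono T f hf hgen _ _ hx
        simp [vtx] at hb
      · intro x _ _
        exact hf.1 p c x
    have := hle p
    dsimp only at this
    linarith
  · rintro rfl
    rw [Finset.ssubset_iff_of_subset (by simpa using hj)]
    refine ⟨i, by simpa using hi, ?_⟩
    rw [Finset.mem_singleton]
    rintro rfl
    exact hne rfl
end

section
/- The map θ from the set T_{n,k} of n,k-complete perfect phylogeny trees to the set A_{n,k} of n,k-complete perfect phylogeny matrices, sending a tree T to the matrix whose row indexed by (c,i) is the state vector of the vertex v_{(c,i)} of T (and whose row indexed by (*,0) is the all-zero vector), is a surjection: every A ∈ A_{n,k} equals θ(T) for some T ∈ T_{n,k}. Moreover, the trees T with θ(T) = A are exactly the spanning trees of G(A) rooted at the all-zero row. -/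
open Finset
open scoped Classical

variable {m n k : ℕ} [NeZero k]

/-- An `n,k`-complete perfect phylogeny matrix `A`, with rows indexed by the
root `(*,0)` (encoded `none`) and the pairs `(c,i) ∈ [n]×[k−1]`: the root row
is all-zero, `a_{(c,i),c} = i`, and the graph `G(A)` on the rows of `A`
joining two rows at Hamming distance 1 is connected. -/
def IsCPPMatrix (A : PPVert n k → Fin n → Fin k) : Prop :=
  (∀ d, A none d = 0) ∧
  (∀ (c : Fin n) (i : {i : Fin k // i ≠ 0}), A (some (c, i)) c = i.1) ∧
  (SimpleGraph.fromRel fun r s : PPVert n k =>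
      (Finset.univ.filter fun d => A r d ≠ A s d).card = 1).Connected

/-- `A = θ(T)`: the row of `A` indexed by `(c,i)` is the state vector of the
vertex `v_{(c,i)}` of `T`, i.e. the root row is all-zero and the row of
`v_{(c,i)}` agrees with the row of its parent except at character `c`, where
it equals `i`. -/
def IsThetaOf (T : CPPTree n k) (A : PPVert n k → Fin n → Fin k) : Prop :=
  (∀ d, A none d = 0) ∧
  ∀ (c : Fin n) (i : {i : Fin k // i ≠ 0}),
    A (some (c, i)) = Function.update (A (T.parent c i)) c i.1

/-- `T` is a spanning tree of `G(A)` (rooted at the all-zero row): every tree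
edge joins two rows of `A` at Hamming distance 1. -/
def IsSpanningTreeOf (T : CPPTree n k) (A : PPVert n k → Fin n → Fin k) : Prop :=
  ∀ (c : Fin n) (i : {i : Fin k // i ≠ 0}),
    (Finset.univ.filter fun d => A (T.parent c i) d ≠ A (some (c, i)) d).card = 1

theorem cpp_depth_le (T : CPPTree n k) (A : PPVert n k → Fin n → Fin k) (h : IsThetaOf T A)
    (c : Fin n) (i : {i : Fin k // i ≠ 0}) :
    ∀ (N : ℕ) (v : PPVert n k), T.depth v ≤ N → A v c = i.1 →
      T.depth (some (c, i)) ≤ T.depth v := by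
  intro N
  induction N using Nat.strong_induction_on with
  | _ N ih =>
    intro v hv hA
    rcases v with _ | ⟨d, j⟩
    · exact absurd (hA.symm.trans (h.1 c)) i.2
    · by_cases hdc : c = d
      · subst hdc
        rw [h.2, Function.update_self] at hA
        have : j = i := Subtype.ext hA
        rw [this]
      · rw [h.2, Function.update_of_ne hdc] at hA
        have h1 := T.depth_lt d j
        have := ih (T.depth (T.parent d j)) (by omega) _ le_rfl hA
        omega

theorem cpp_intro (T : CPPTree n k) (A : PPVert n k → Fin n → Fin k) (h0 : ∀ d, A none d = 0)
    (c : Fin n) (i : {i : Fin k // i ≠ 0}) :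
    ∀ (N : ℕ) (v : Fin n × {i : Fin k // i ≠ 0}), T.depth (some v) ≤ N → A (some v) c = i.1 →
      ∃ w : Fin n × {i : Fin k // i ≠ 0}, A (some w) c = i.1 ∧ A (T.parent w.1 w.2) c ≠ i.1 ∧
        (w = v ∨ T.depth (some w) < T.depth (some v)) := by
  intro N
  induction N using Nat.strong_induction_on with
  | _ N ih =>
    intro v hv hA
    by_cases hp : A (T.parent v.1 v.2) c = i.1
    · have h1 := T.depth_lt v.1 v.2
      cases hu : T.parent v.1 v.2 with
      | none =>
        rw [hu] at hp
        exact absurd (hp.symm.trans (h0 c)) i.2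
      | some u =>
        rw [hu] at hp h1
        have h1' : T.depth (some u) < T.depth (some v) := h1
        obtain ⟨w, hw1, hw2, hw3⟩ := ih (T.depth (some u)) (by omega) u le_rfl hp
        refine ⟨w, hw1, hw2, Or.inr ?_⟩
        rcases hw3 with rfl | hw3
        · exact h1'
        · omega
    · exact ⟨v, hA, hp, Or.inl rfl⟩

theorem cpp_span_theta (T : CPPTree n k) (A : PPVert n k → Fin n → Fin k) (h0 : ∀ d, A none d = 0)
    (h1 : ∀ (c : Fin n) (i : {i : Fin k // i ≠ 0}), A (some (c, i)) c = i.1)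
    (hS : IsSpanningTreeOf T A) : IsThetaOf T A := by
  have hex : ∀ x : Fin n × {i : Fin k // i ≠ 0}, ∃ w : Fin n × {i : Fin k // i ≠ 0},
      A (some w) x.1 = x.2.1 ∧ A (T.parent w.1 w.2) x.1 ≠ x.2.1 ∧
        (w = x ∨ T.depth (some w) < T.depth (some x)) := fun x =>
    cpp_intro T A h0 x.1 x.2 _ x le_rfl (h1 x.1 x.2)
  choose g hg1 hg2 hg3 using hex
  have huniq : ∀ (w : Fin n × {i : Fin k // i ≠ 0}) (a b : Fin n),
      A (T.parent w.1 w.2) a ≠ A (some w) a → A (T.parent w.1 w.2) b ≠ A (some w) b → a = b := by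
    intro w a b ha hb
    have := hS w.1 w.2
    exact Finset.card_le_one.mp this.le a (by simpa using ha) b (by simpa using hb)
  have hd : ∀ x, A (T.parent (g x).1 (g x).2) x.1 ≠ A (some (g x)) x.1 := by
    intro x
    rw [hg1]
    exact hg2 x
  have hinj : Function.Injective g := by
    intro x y hxy
    have e1 : x.1 = y.1 := by
      refine huniq (g x) _ _ (hd x) ?_
      rw [hxy]
      exact hd y
    have e2 : x.2.1 = y.2.1 := by
      rw [← hg1 x, ← hg1 y, hxy, e1]
    exact Prod.ext e1 (Subtype.ext e2)
  have hbij : Function.Bijective g := Finite.injective_iff_bijective.mp hinj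
  have hsum : ∑ x, T.depth (some (g x)) = ∑ x, T.depth (some x) :=
    hbij.sum_comp (fun x => T.depth (some x))
  have hle : ∀ x ∈ (Finset.univ : Finset (Fin n × {i : Fin k // i ≠ 0})),
      T.depth (some (g x)) ≤ T.depth (some x) := by
    intro x _
    rcases hg3 x with h | h
    · rw [h]
    · exact h.le
  have hid : ∀ x, g x = x := by
    intro x
    have := (Finset.sum_eq_sum_iff_of_le hle).mp hsum x (Finset.mem_univ x)
    rcases hg3 x with h | h
    · exact h
    · omega
  refine ⟨h0, fun c i => ?_⟩
  funext d
  by_cases hdc : d = c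
  · subst hdc
    rw [Function.update_self, h1]
  · rw [Function.update_of_ne hdc]
    by_contra hne
    apply hdc
    have h2 := hd (c, i)
    rw [hid] at h2
    exact huniq (c, i) _ _ (fun h => hne h.symm) h2

theorem cpp_theta_span (T : CPPTree n k) (A : PPVert n k → Fin n → Fin k)
    (h : IsThetaOf T A) : IsSpanningTreeOf T A := by
  intro c i
  rw [Finset.card_eq_one]
  refine ⟨c, ?_⟩
  ext d
  simp only [Finset.mem_filter, Finset.mem_univ, true_and, Finset.mem_singleton]
  rw [h.2 c i]
  constructor
  · intro hd
    by_contra hdc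
    rw [Function.update_of_ne hdc] at hd
    exact hd rfl
  · rintro rfl
    rw [Function.update_self]
    intro hA
    have h1 := cpp_depth_le T A h d i _ _ le_rfl hA
    have h2 := T.depth_lt d i
    omega

theorem cpp_exists_parent {V : Type*} (G : SimpleGraph V) (hG : G.Connected) (r v : V)
    (hv : v ≠ r) : ∃ u, G.Adj u v ∧ G.dist r u < G.dist r v := by
  obtain ⟨p, hp⟩ := hG.exists_walk_length_eq_dist v r
  cases p with
  | nil => exact absurd rfl hv
  | cons hadj q =>
    refine ⟨_, hadj.symm, ?_⟩
    rw [SimpleGraph.dist_comm, SimpleGraph.dist_comm (u := r) (v := v), ← hp,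
      SimpleGraph.Walk.length_cons]
    have := SimpleGraph.dist_le q
    omega

/-- **Lemma A1.** The map `θ` from `n,k`-complete perfect
phylogeny trees to `n,k`-complete perfect phylogeny matrices is a surjection,
and the trees `T` with `θ(T) = A` are exactly the spanning trees of `G(A)`
rooted at the all-zero row. -/
theorem theta_surjective_and_fibers (A : PPVert n k → Fin n → Fin k)
    (hA : IsCPPMatrix A) :
    (∃ T : CPPTree n k, IsThetaOf T A) ∧
    ∀ T : CPPTree n k, IsThetaOf T A ↔ IsSpanningTreeOf T A := by
  obtain ⟨h0, h1, hG⟩ := hA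
  refine ⟨?_, fun T => ⟨cpp_theta_span T A, cpp_span_theta T A h0 h1⟩⟩
  have hp := fun x : Fin n × {i : Fin k // i ≠ 0} =>
    cpp_exists_parent _ hG none (some x) (by simp)
  choose f hf1 hf2 using hp
  refine ⟨⟨fun c i => f (c, i), _, fun c i => hf2 (c, i)⟩, cpp_span_theta _ A h0 h1 ?_⟩
  intro c i
  have h := hf1 (c, i)
  rw [SimpleGraph.fromRel_adj] at h
  rcases h.2 with h | h
  · exact h
  · refine Eq.trans ?_ h
    congr 1
    ext d
    simp [ne_comm]
end

section
/- Let T be an n,k-complete perfect phylogeny tree and F a frequency tensor. For every character-state pair (c,i) and sample p, f_{p,(c,i)} = f⁺_p(D_{(c,i)}) − Σ_{(c,l)∈Δ(c,i)} f⁺_p(D_{(c,l)}), where Δ(c,i) is the set of character-state pairs (c,l) with l ≠ i such that v_{(c,l)} is not in T_{(c,i)} but the parent of v_{(c,l)} is in T_{(c,i)}. In particular, the sets D_{(c,l)} for (c,l) ∈ Δ(c,i) are pairwise disjoint and their union equals D_{(c,i)} ∖ {i}. -/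
open Finset
open scoped Classical

variable {m n k : ℕ} [NeZero k]

/-- `Δ(c,i)`: the set of states `l ≠ i` such that the vertex `v_{(c,l)}` is
not in `T_{(c,i)}` but the parent of `v_{(c,l)}` is in `T_{(c,i)}`. -/
noncomputable def bigDelta (T : CPPTree n k) (c : Fin n) (i : Fin k) :
    Finset (Fin k) :=
  Finset.univ.filter fun l : Fin k =>
    ∃ h : l ≠ 0, l ≠ i ∧ ¬ T.hasState (some (c, ⟨l, h⟩)) c i ∧
      T.hasState (T.parent c ⟨l, h⟩) c i

theorem CPPTree.anc_depth (T : CPPTree n k) {u v : PPVert n k} (h : T.anc u v) :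
    u = v ∨ T.depth u < T.depth v := by
  induction h with
  | refl => exact Or.inl rfl
  | tail _ h2 ih =>
    obtain ⟨c, i, rfl, rfl⟩ := h2
    have := T.depth_lt c i
    rcases ih with rfl | ih
    · exact Or.inr this
    · exact Or.inr (ih.trans this)

theorem CPPTree.anc_antisymm (T : CPPTree n k) {u v : PPVert n k} (h : T.anc u v)
    (h' : T.anc v u) : u = v := by
  rcases T.anc_depth h with h | h
  · exact h
  · rcases T.anc_depth h' with h' | h'
    · exact h'.symm
    · omega

theorem CPPTree.anc_trans (T : CPPTree n k) {u v w : PPVert n k} (h : T.anc u v)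
    (h' : T.anc v w) : T.anc u w := Relation.ReflTransGen.trans h h'

theorem CPPTree.anc_some (T : CPPTree n k) {u : PPVert n k} {c : Fin n}
    {i : {i : Fin k // i ≠ 0}} :
    T.anc u (some (c, i)) ↔ u = some (c, i) ∨ T.anc u (T.parent c i) := by
  constructor
  · intro h
    rcases Relation.ReflTransGen.cases_tail h with h | ⟨w, h1, d, j, h2, h3⟩
    · exact Or.inl h.symm
    · obtain ⟨rfl, rfl⟩ := Prod.mk.inj (Option.some.inj h2)
      subst h3
      exact Or.inr h1
  · rintro (rfl | h)
    · exact Relation.ReflTransGen.refl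
    · exact Relation.ReflTransGen.tail h ⟨c, i, rfl, rfl⟩

theorem CPPTree.anc_none (T : CPPTree n k) {u : PPVert n k} (h : T.anc u none) : u = none := by
  rcases Relation.ReflTransGen.cases_tail h with h | ⟨w, h1, d, j, h2, h3⟩
  · exact h.symm
  · cases h2

theorem CPPTree.anc_total (T : CPPTree n k) {u v w : PPVert n k} (h : T.anc u w)
    (h' : T.anc v w) : T.anc u v ∨ T.anc v u := by
  induction h with
  | refl => exact Or.inr h'
  | tail h1 h2 ih =>
    obtain ⟨c, i, rfl, rfl⟩ := h2
    rcases T.anc_some.1 h' with rfl | h'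
    · exact Or.inl (T.anc_some.2 (Or.inr h1))
    · exact ih h'

theorem vtx_inj' {c : Fin n} {i j : Fin k} (h : vtx c i = vtx c j) : i = j := by
  unfold vtx at h
  split_ifs at h with h1 h2 h2
  · exact h1.trans h2.symm
  · simpa using h

theorem mem_bigDelta' (T : CPPTree n k) (c : Fin n) (i l : Fin k) :
    l ∈ bigDelta T c i ↔ l ≠ i ∧ T.anc (vtx c i) (vtx c l) ∧
      ∀ j, T.anc (vtx c j) (vtx c l) → j = l ∨ T.anc (vtx c j) (vtx c i) := by
  simp only [bigDelta, Finset.mem_filter, Finset.mem_univ, true_and]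
  constructor
  · rintro ⟨h0, hi, -, h1, h2⟩
    have e : vtx c l = some (c, ⟨l, h0⟩) := by simp [vtx, h0]
    refine ⟨hi, ?_, ?_⟩
    · rw [e]; exact T.anc_some.2 (Or.inr h1)
    · intro j hj
      rw [e] at hj
      rcases T.anc_some.1 hj with hj | hj
      · exact Or.inl (vtx_inj' (hj.trans e.symm))
      · exact Or.inr (h2 j hj)
  · rintro ⟨hi, h1, h2⟩
    have h0 : l ≠ 0 := by
      rintro rfl
      have e : vtx c (0 : Fin k) = none := by simp [vtx]
      have h3 := h1
      rw [e] at h3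
      exact hi (vtx_inj' (e.trans (T.anc_none h3).symm))
    have e : vtx c l = some (c, ⟨l, h0⟩) := by simp [vtx, h0]
    refine ⟨h0, hi, ?_, ?_, ?_⟩
    · rintro ⟨-, h⟩
      have h3 := h l (by rw [e]; exact Relation.ReflTransGen.refl)
      exact hi (vtx_inj' (T.anc_antisymm h3 h1))
    · have h3 := h1
      rw [e] at h3
      rcases T.anc_some.1 h3 with h | h
      · exact absurd (vtx_inj' (h.trans e.symm)).symm hi
      · exact h
    · intro j hj
      have h3 : T.anc (vtx c j) (vtx c l) := by rw [e]; exact T.anc_some.2 (Or.inr hj)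
      rcases h2 j h3 with rfl | h
      · exfalso
        have hd := T.depth_lt c ⟨j, h0⟩
        rw [e] at hj
        rcases T.anc_depth hj with h | h
        · rw [← h] at hd; omega
        · omega
      · exact h

/-- For every character-state pair `(c,i)` and sample `p`,
`f_{p,(c,i)} = f⁺_p(D_{(c,i)}) − Σ_{(c,l)∈Δ(c,i)} f⁺_p(D_{(c,l)})`.
In particular, the sets `D_{(c,l)}` for `(c,l) ∈ Δ(c,i)` are pairwise
disjoint and their union is `D_{(c,i)} ∖ {i}`. -/
theorem freq_via_boundary (T : CPPTree n k) (f : Fin m → Fin n → Fin k → ℝ)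
    (hf : IsFreqTensor f) (c : Fin n) (i : Fin k) :
    (∀ p : Fin m,
        f p c i = fplus f p c (T.D c i) -
          ∑ l ∈ bigDelta T c i, fplus f p c (T.D c l)) ∧
    ((bigDelta T c i : Set (Fin k)).Pairwise fun l l' =>
        Disjoint (T.D c l) (T.D c l')) ∧
    (bigDelta T c i).biUnion (fun l => T.D c l) = (T.D c i).erase i := by
  have hdis : (bigDelta T c i : Set (Fin k)).Pairwise fun l l' =>
      Disjoint (T.D c l) (T.D c l') := by
    intro l hl l' hl' hne
    obtain ⟨a1, a2, a3⟩ := (mem_bigDelta' T c i l).1 hl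
    obtain ⟨b1, b2, b3⟩ := (mem_bigDelta' T c i l').1 hl'
    rw [Finset.disjoint_left]
    intro x hx hx'
    simp only [CPPTree.D, Finset.mem_filter, Finset.mem_univ, true_and] at hx hx'
    rcases T.anc_total hx hx' with h | h
    · rcases b3 l h with h | h
      · exact hne h
      · exact a1 (vtx_inj' (T.anc_antisymm h a2))
    · rcases a3 l' h with h | h
      · exact hne h.symm
      · exact b1 (vtx_inj' (T.anc_antisymm h b2))
  have hun : (bigDelta T c i).biUnion (fun l => T.D c l) = (T.D c i).erase i := by
    ext x
    simp only [Finset.mem_biUnion, mem_bigDelta', CPPTree.D, Finset.mem_filter,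
      Finset.mem_univ, true_and, Finset.mem_erase]
    constructor
    · rintro ⟨l, ⟨a1, a2, a3⟩, hx⟩
      refine ⟨?_, T.anc_trans a2 hx⟩
      rintro rfl
      exact a1 (vtx_inj' (T.anc_antisymm hx a2))
    · rintro ⟨hx, hix⟩
      obtain ⟨l, hl, hmin⟩ := Finset.exists_min_image
        (Finset.univ.filter fun j : Fin k =>
          j ≠ i ∧ T.anc (vtx c i) (vtx c j) ∧ T.anc (vtx c j) (vtx c x))
        (fun j => T.depth (vtx c j)) ⟨x, by simpa using ⟨hx, hix, Relation.ReflTransGen.refl⟩⟩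
      simp only [Finset.mem_filter, Finset.mem_univ, true_and] at hl hmin
      obtain ⟨l1, l2, l3⟩ := hl
      refine ⟨l, ⟨l1, l2, ?_⟩, l3⟩
      intro j hj
      rcases T.anc_total hj l2 with h | h
      · exact Or.inr h
      · by_cases hji : j = i
        · subst hji; exact Or.inr h
        · have := hmin j ⟨hji, h, T.anc_trans hj l3⟩
          rcases T.anc_depth hj with h | h
          · exact Or.inl (vtx_inj' h)
          · omega
  refine ⟨?_, hdis, hun⟩
  intro p
  have hi : i ∈ T.D c i := by
    simp only [CPPTree.D, Finset.mem_filter, Finset.mem_univ, true_and]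
    exact Relation.ReflTransGen.refl
  have h1 : ∑ l ∈ bigDelta T c i, fplus f p c (T.D c l) = ∑ l ∈ (T.D c i).erase i, f p c l := by
    rw [← hun, Finset.sum_biUnion hdis]
    rfl
  have h2 := Finset.add_sum_erase (T.D c i) (fun l => f p c l) hi
  rw [h1]
  unfold fplus
  linarith
end
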